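/- There exists a constant C > 0 such that every finite set X ⊆ ℝ² of N ≥ 2 points in general position is contained in a Jordan curve with stabbing number at most C·√N. -/

import Mathlib

open Set

/-- Points of the plane. -/
abbrev Pt := ℝ × ℝ

/-- An affine line in ℝ², given by a nontrivial linear equation. -/
def IsAffLine (l : Set Pt) : Prop :=
  ∃ a b c : ℝ, (a ≠ 0 ∨ b ≠ 0) ∧ l = {p : Pt | a * p.1 + b * p.2 = c}

/-- An open half-plane in ℝ². -/
def IsOpenHalfPlane (H : Set Pt) : Prop :=
  ∃ a b c : ℝ, (a ≠ 0 ∨ b ≠ 0) ∧ H = {p : Pt | a * p.1 + b * p.2 < c}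

/-- `A` and `B` are linearly separable: some affine line has `A` strictly on
one side and `B` strictly on the other side. -/
def LinSep (A B : Set Pt) : Prop :=
  ∃ a b c : ℝ, (a ≠ 0 ∨ b ≠ 0) ∧ (∀ p ∈ A, a * p.1 + b * p.2 < c) ∧
    (∀ p ∈ B, c < a * p.1 + b * p.2)

/-- General position: no three (distinct) points of `X` are collinear. -/
def GenPos (X : Set Pt) : Prop :=
  ∀ p ∈ X, ∀ q ∈ X, ∀ r ∈ X, p ≠ q → p ≠ r → q ≠ r →
    ¬ Collinear ℝ ({p, q, r} : Set Pt)

/-- Convex position: no point of `X` lies in the convex hull of the others. -/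
def ConvexPos (X : Set Pt) : Prop :=
  ∀ p ∈ X, p ∉ convexHull ℝ (X \ {p})

/-- A cell of an arrangement `L` of lines: a connected component of the
complement of the union of the lines. -/
def IsCell (L : Set (Set Pt)) (cell : Set Pt) : Prop :=
  ∃ p ∈ (⋃₀ L)ᶜ, cell = connectedComponentIn (⋃₀ L)ᶜ p

/-- `S` has at most `d` connected components: among any `d + 1` points of `S`,
two lie in the same connected component of `S`. -/
def CompsLE (S : Set Pt) (d : ℕ) : Prop :=
  ∀ f : Fin (d + 1) → Pt, (∀ i, f i ∈ S) →
    ∃ i j, i ≠ j ∧ connectedComponentIn S (f i) = connectedComponentIn S (f j)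

/-- A Jordan curve: the image of a continuous injective map from the unit
circle to the plane. -/
def IsJordanCurve (J : Set Pt) : Prop :=
  ∃ f : EuclideanSpace ℝ (Fin 2) → Pt,
    ContinuousOn f (Metric.sphere 0 1) ∧ Set.InjOn f (Metric.sphere 0 1) ∧
      J = f '' (Metric.sphere 0 1)

/-- `J` has stabbing number at most `d` (a natural number): every affine line
meets `J` in at most `d` connected components. -/
def StabLE (J : Set Pt) (d : ℕ) : Prop :=
  ∀ l, IsAffLine l → CompsLE (J ∩ l) d

/-- `J` has stabbing number at most a real number `d`: every affine line meets
`J` in at most `⌊d⌋₊` connected components. -/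
def StabLER (J : Set Pt) (d : ℝ) : Prop :=
  ∀ l, IsAffLine l → CompsLE (J ∩ l) ⌊d⌋₊

/-- vertical signed distance to the line `y = s x + t`, `L = (s,t)`. -/
def lf (L : ℝ × ℝ) (p : Pt) : ℝ := p.2 - L.1 * p.1 - L.2

lemma ray_select {κ : Type*} (T : Finset κ) (w : κ → ℝ) (hw : ∀ i, 0 ≤ w i) (g : κ → ℝ) (r : ℝ)
    (h : r ≤ ∑ i ∈ T, w i) :
    r ≤ ∑ i ∈ T.filter (fun i => ∑ j ∈ T.filter (fun j => g j < g i), w j < r), w i := by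
  classical
  by_cases hS : T.filter (fun i => ∑ j ∈ T.filter (fun j => g j < g i), w j < r) = T
  · rw [hS]; exact h
  · have hne : (T.filter (fun i => ¬ (∑ j ∈ T.filter (fun j => g j < g i), w j < r))).Nonempty := by
      rw [Finset.nonempty_iff_ne_empty]
      intro he
      apply hS
      rw [Finset.filter_eq_self]
      intro x hx
      by_contra hc
      have : x ∈ (T.filter (fun i => ¬ (∑ j ∈ T.filter (fun j => g j < g i), w j < r))) :=
        Finset.mem_filter.2 ⟨hx, hc⟩
      rw [he] at this
      simp at this
    obtain ⟨i, hi, hmin⟩ := Finset.exists_min_image _ g hne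
    rw [Finset.mem_filter] at hi
    have h1 := not_lt.1 hi.2
    refine h1.trans (Finset.sum_le_sum_of_subset_of_nonneg ?_ (fun i _ _ => hw i))
    intro j hj
    rw [Finset.mem_filter] at hj ⊢
    refine ⟨hj.1, ?_⟩
    by_contra hc
    have := hmin j (Finset.mem_filter.2 ⟨hj.1, hc⟩)
    linarith [hj.2]

/-- abscissa of the intersection of two lines -/
noncomputable def ux (A B : ℝ × ℝ) : ℝ := (B.2 - A.2) / (A.1 - B.1)

/-- intersection of two lines -/
noncomputable def vtx (A B : ℝ × ℝ) : Pt := (ux A B, A.1 * ux A B + A.2)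

lemma lf_on (A K : ℝ × ℝ) (h : A.1 ≠ K.1) (x : ℝ) :
    lf K (x, A.1 * x + A.2) = (A.1 - K.1) * (x - ux A K) := by
  have : A.1 - K.1 ≠ 0 := sub_ne_zero.2 h
  unfold lf ux
  field_simp
  ring

lemma lf_vtx_self (A B : ℝ × ℝ) : lf A (vtx A B) = 0 := by
  unfold lf vtx; simp

section ball
variable {κ : Type*} [Fintype κ] [DecidableEq κ]

/-- weight of separating lines -/
noncomputable def dsep (L : κ → ℝ × ℝ) (w : κ → ℝ) (p q : Pt) : ℝ :=
  ∑ k ∈ Finset.univ.filter (fun k => lf (L k) p * lf (L k) q < 0), w k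

lemma half_split (T : Finset κ) (w : κ → ℝ) (hw : ∀ i, 0 ≤ w i) (P Q : κ → Prop) [DecidablePred P]
    [DecidablePred Q] (h : ∀ i ∈ T, P i ∨ Q i) (r : ℝ) (hr : 2 * r ≤ ∑ i ∈ T, w i) :
    r ≤ ∑ i ∈ T.filter P, w i ∨ r ≤ ∑ i ∈ T.filter Q, w i := by
  by_contra hc
  push Not at hc
  have : ∑ i ∈ T, w i ≤ ∑ i ∈ T.filter P, w i + ∑ i ∈ T.filter Q, w i := by
    rw [← Finset.sum_union_inter]
    have h1 : T.filter P ∪ T.filter Q = T := by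
      ext x; simp only [Finset.mem_union, Finset.mem_filter]
      constructor
      · tauto
      · intro hx; have := h x hx; tauto
    rw [h1]
    have := Finset.sum_nonneg (s := T.filter P ∩ T.filter Q) (fun i _ => hw i)
    linarith
  linarith

lemma step_vert (L : κ → ℝ × ℝ) (w : κ → ℝ) (hw : ∀ i, 0 ≤ w i) (p : Pt) 
    (hp : ∀ i, lf (L i) p ≠ 0) (ρ : ℝ) (hρ : 2 * ρ ≤ ∑ i, w i) :
    ∃ S : Finset κ, ρ ≤ ∑ i ∈ S, w i ∧ ∀ i ∈ S,
      dsep L w p (p.1, (L i).1 * p.1 + (L i).2) < ρ := by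
  have key : ∀ P : κ → Prop, ∀ [DecidablePred P], 
      (∀ i j, P i → lf (L j) p * lf (L i) p > 0 → P j) →
      ρ ≤ ∑ i ∈ Finset.univ.filter P, w i → ∃ S : Finset κ, ρ ≤ ∑ i ∈ S, w i ∧ ∀ i ∈ S,
      dsep L w p (p.1, (L i).1 * p.1 + (L i).2) < ρ := by
    intro P _ hP h
    refine ⟨_, ray_select _ w hw (fun i => |lf (L i) p|) ρ h, ?_⟩
    intro i hi
    rw [Finset.mem_filter] at hi
    refine lt_of_le_of_lt ?_ hi.2
    unfold dsep
    refine Finset.sum_le_sum_of_subset_of_nonneg ?_ (fun i _ _ => hw i)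
    intro j hj
    simp only [Finset.mem_filter, Finset.mem_univ, true_and] at hj hi ⊢
    have e : lf (L j) (p.1, (L i).1 * p.1 + (L i).2) = lf (L j) p - lf (L i) p := by
      unfold lf; ring
    rw [e] at hj
    have h1 : lf (L j) p * lf (L i) p > 0 := by nlinarith [sq_nonneg (lf (L j) p)]
    refine ⟨hP i j hi.1 h1, ?_⟩
    rw [← sq_lt_sq]
    rcases lt_or_gt_of_ne (hp j) with h2 | h2
    · have : lf (L i) p < 0 := by nlinarith
      nlinarith
    · have : lf (L i) p > 0 := by nlinarith
      nlinarith
  rcases half_split Finset.univ w hw (fun i => lf (L i) p < 0) (fun i => lf (L i) p > 0)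
    (fun i _ => lt_or_gt_of_ne (hp i)) ρ hρ with h | h
  · exact key _ (fun i j hi hj => by nlinarith) h
  · exact key _ (fun i j hi hj => by nlinarith) h

lemma step_line (L : κ → ℝ × ℝ) (hL : ∀ i j, i ≠ j → (L i).1 ≠ (L j).1) (w : κ → ℝ) 
    (hw : ∀ i, 0 ≤ w i) (p : Pt) (hp : ∀ i, lf (L i) p ≠ 0) (ρ : ℝ) (i : κ) 
    (hρ : 2 * ρ ≤ (∑ i, w i) - w i)
    (hi : dsep L w p (p.1, (L i).1 * p.1 + (L i).2) < ρ) :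
    ρ ≤ ∑ j ∈ Finset.univ.filter (fun j => i ≠ j ∧ dsep L w p (vtx (L i) (L j)) < 2 * ρ), w j := by
  have hsum : ∑ j ∈ Finset.univ.erase i, w j = (∑ i, w i) - w i := by
    rw [← Finset.add_sum_erase _ _ (Finset.mem_univ i)]; ring
  have key : ∀ P : κ → Prop, ∀ [DecidablePred P], 
      (∀ j k, P j → i ≠ k → (p.1 - ux (L i) (L k)) * (ux (L i) (L j) - ux (L i) (L k)) < 0 ∨
        ux (L i) (L k) = p.1 → P k) →
      ρ ≤ ∑ j ∈ (Finset.univ.erase i).filter P, w j → 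
      ρ ≤ ∑ j ∈ Finset.univ.filter 
        (fun j => i ≠ j ∧ dsep L w p (vtx (L i) (L j)) < 2 * ρ), w j := by
    intro P _ hP h
    refine (ray_select _ w hw (fun j => |ux (L i) (L j) - p.1|) ρ h).trans ?_
    refine Finset.sum_le_sum_of_subset_of_nonneg ?_ (fun i _ _ => hw i)
    intro j hj
    simp only [Finset.mem_filter, Finset.mem_univ, true_and, Finset.mem_erase, and_true] at hj ⊢
    obtain ⟨⟨hji, hPj⟩, hlt⟩ := hj
    refine ⟨fun h => hji h.symm, ?_⟩
    have : dsep L w p (vtx (L i) (L j)) ≤ dsep L w p (p.1, (L i).1 * p.1 + (L i).2) + 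
       ∑ k ∈ ((Finset.univ.erase i).filter P).filter 
        (fun k => |ux (L i) (L k) - p.1| < |ux (L i) (L j) - p.1|), w k := by
      unfold dsep
      rw [← Finset.sum_union_inter]
      refine le_add_of_le_of_nonneg ?_ (Finset.sum_nonneg (fun i _ => hw i))
      refine Finset.sum_le_sum_of_subset_of_nonneg ?_ (fun i _ _ => hw i)
      intro k hk
      simp only [Finset.mem_filter, Finset.mem_univ, true_and, Finset.mem_erase, and_true,
        Finset.mem_union] at hk ⊢
      by_cases hik : i = k
      · subst hik
        rw [lf_vtx_self] at hk; simp at hk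
      have hs := hL i k hik
      unfold vtx at hk
      rw [lf_on _ _ hs] at hk ⊢
      set a := (L i).1 - (L k).1
      set u := ux (L i) (L k)
      set v := ux (L i) (L j)
      set c := lf (L k) p
      have ha : a ≠ 0 := sub_ne_zero.2 hs
      by_cases h1 : c * (a * (p.1 - u)) < 0
      · left; exact h1
      right
      have h2 : (p.1 - u) * (v - u) < 0 ∨ u = p.1 := by
        by_contra hc
        push Not at hc
        have h3 : p.1 - u ≠ 0 := sub_ne_zero.2 (fun h => hc.2 h.symm)
        have hac : c * a ≠ 0 := mul_ne_zero (hp k) ha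
        have h4 : (c * a) * (p.1 - u) ≥ 0 := by linarith
        have h5 : (c * a) * (v - u) < 0 := by linarith
        rcases lt_or_gt_of_ne hac with h6 | h6
        · have : p.1 - u ≤ 0 := by nlinarith
          have : v - u > 0 := by nlinarith
          have : p.1 - u < 0 := lt_of_le_of_ne (by assumption) h3
          nlinarith
        · have : p.1 - u ≥ 0 := by nlinarith
          have : v - u < 0 := by nlinarith
          have : p.1 - u > 0 := lt_of_le_of_ne (by assumption) h3.symm
          nlinarith
      refine ⟨⟨fun h => hik h.symm, hP j k hPj hik h2⟩, ?_⟩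
      rcases h2 with h2 | h2
      · rw [← sq_lt_sq]
        nlinarith
      · rw [h2, sub_self, abs_zero, abs_pos]
        intro h
        have : v = p.1 := by linarith
        rw [this, h2] at hk
        simp at hk
    linarith
  rcases half_split (Finset.univ.erase i) w hw (fun j => ux (L i) (L j) ≤ p.1) 
    (fun j => p.1 ≤ ux (L i) (L j)) (fun j _ => le_total _ _) ρ (by rw [hsum]; exact hρ) with h | h
  · refine key _ (fun j k hj _ hk => ?_) h
    rcases hk with hk | hk
    · nlinarith
    · exact hk.le
  · refine key _ (fun j k hj _ hk => ?_) h
    rcases hk with hk | hk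
    · nlinarith
    · exact hk.ge

lemma ball_weight (L : κ → ℝ × ℝ) (hL : ∀ i j, i ≠ j → (L i).1 ≠ (L j).1) (w : κ → ℝ) 
    (hw : ∀ i, 0 ≤ w i) (p : Pt) (hp : ∀ i, lf (L i) p ≠ 0) (ρ : ℝ) (hρ0 : 0 ≤ ρ)
    (hρ' : 2 * ρ ≤ (∑ i, w i)) (hρ : ∀ i, 2 * ρ ≤ (∑ i, w i) - w i) :
    ρ * ρ ≤ ∑ z ∈ (Finset.univ : Finset (κ × κ)).filter 
      (fun z => z.1 ≠ z.2 ∧ dsep L w p (vtx (L z.1) (L z.2)) < 2 * ρ), w z.1 * w z.2 := by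
  obtain ⟨S, hS, hS2⟩ := step_vert L w hw p hp ρ hρ'
  calc ρ * ρ ≤ (∑ i ∈ S, w i) * ρ := mul_le_mul_of_nonneg_right hS hρ0
    _ = ∑ i ∈ S, w i * ρ := by rw [Finset.sum_mul]
    _ ≤ ∑ i ∈ S, w i * ∑ j ∈ Finset.univ.filter 
          (fun j => i ≠ j ∧ dsep L w p (vtx (L i) (L j)) < 2 * ρ), w j := 
        Finset.sum_le_sum fun i hi => mul_le_mul_of_nonneg_left 
          (step_line L hL w hw p hp ρ i (hρ i) (hS2 i hi)) (hw i)
    _ ≤ ∑ i, w i * ∑ j ∈ Finset.univ.filter 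
          (fun j => i ≠ j ∧ dsep L w p (vtx (L i) (L j)) < 2 * ρ), w j := 
        Finset.sum_le_sum_of_subset_of_nonneg (Finset.subset_univ _) 
          (fun i _ _ => mul_nonneg (hw i) (Finset.sum_nonneg fun j _ => hw j))
    _ = _ := by
        rw [Finset.sum_filter, ← Finset.univ_product_univ, Finset.sum_product]
        refine Finset.sum_congr rfl fun i _ => ?_
        rw [Finset.mul_sum, Finset.sum_filter]

lemma short_generic (L : κ → ℝ × ℝ) (hL : ∀ i j, i ≠ j → (L i).1 ≠ (L j).1) 
    (hL3 : ∀ i j k, i ≠ j → k ≠ i → k ≠ j → lf (L k) (vtx (L i) (L j)) ≠ 0) (w : κ → ℝ) 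
    (hw : ∀ i, 0 ≤ w i) (X : Finset Pt) (hX : 2 ≤ X.card) (hp : ∀ p ∈ X, ∀ i, lf (L i) p ≠ 0) 
    (hw2 : ∀ i, w i ≤ (∑ i, w i) / X.card) :
    ∃ p ∈ X, ∃ q ∈ X, p ≠ q ∧ dsep L w p q ≤ 8 / √X.card * ∑ i, w i := by
  set n := X.card with hn
  set W := ∑ i, w i with hW
  have hW0 : 0 ≤ W := Finset.sum_nonneg fun i _ => hw i
  have hn2 : (2 : ℝ) ≤ n := by exact_mod_cast hX
  set R := √(n : ℝ) with hR
  have hRR : R * R = n := Real.mul_self_sqrt (by linarith)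
  have hR0 : 0 < R := Real.sqrt_pos.2 (by linarith)
  have hR1 : 1 < R := by nlinarith
  by_contra hc
  push Not at hc
  obtain ⟨p0, hp0, q0, hq0, hpq0⟩ := Finset.one_lt_card.1 (by omega : 1 < X.card)
  have hd0 : dsep L w p0 q0 ≤ W := 
    Finset.sum_le_sum_of_subset_of_nonneg (Finset.subset_univ _) (fun i _ _ => hw i)
  have hlt := (hc p0 hp0 q0 hq0 hpq0).trans_le hd0
  have hWpos : 0 < W := by
    by_contra h
    have : W = 0 := by linarith
    rw [this] at hlt; simp at hlt
  have hR8 : 8 < R := by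
    rw [div_mul_eq_mul_div, div_lt_iff₀ hR0] at hlt
    nlinarith
  set ρ := 3 / 2 * W / R with hρ
  have hρ0 : 0 < ρ := by positivity
  have hρW : 2 * ρ ≤ 3 / 8 * W := by
    rw [hρ]
    rw [show 2 * (3 / 2 * W / R) = 3 * W / R by ring, div_le_iff₀ hR0]
    nlinarith
  have hnW : W / n ≤ 1 / 8 * (W / R) := by
    rw [← hRR, ← div_div]
    rw [div_le_iff₀ hR0]
    have : 0 < W / R := by positivity
    nlinarith
  have hWR : W / R ≤ W := by
    rw [div_le_iff₀ hR0]; nlinarith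
  let B : Pt → Finset (κ × κ) := fun p => (Finset.univ : Finset (κ × κ)).filter 
      (fun z => z.1 ≠ z.2 ∧ dsep L w p (vtx (L z.1) (L z.2)) < 2 * ρ)
  have hB : ∀ p ∈ X, ρ * ρ ≤ ∑ z ∈ B p, w z.1 * w z.2 := fun p hpX =>
    ball_weight L hL w hw p (hp p hpX) ρ hρ0.le (by linarith) 
      (fun i => by have := hw2 i; linarith)
  have hdisj : (X : Set Pt).PairwiseDisjoint B := by
    intro p hpX q hqX hpq
    rw [Function.onFun, Finset.disjoint_left]
    intro z hz1 hz2
    simp only [B, Finset.mem_filter, Finset.mem_univ, true_and] at hz1 hz2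
    have h1 := hc p hpX q hqX hpq
    have h2 : dsep L w p q ≤ dsep L w p (vtx (L z.1) (L z.2)) + 
        dsep L w q (vtx (L z.1) (L z.2)) + (w z.1 + w z.2) := by
      rw [← Finset.sum_pair hz1.1]
      unfold dsep
      rw [← Finset.sum_union_inter, add_right_comm, ← Finset.sum_union_inter, add_assoc]
      refine le_add_of_le_of_nonneg ?_ (add_nonneg (Finset.sum_nonneg (fun i _ => hw i)) 
        (Finset.sum_nonneg (fun i _ => hw i)))
      refine Finset.sum_le_sum_of_subset_of_nonneg ?_ (fun i _ _ => hw i)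
      intro k hk
      simp only [Finset.mem_filter, Finset.mem_univ, true_and, Finset.mem_insert,
        Finset.mem_singleton, Finset.mem_union] at hk ⊢
      by_cases hk1 : k = z.1
      · tauto
      by_cases hk2 : k = z.2
      · tauto
      left
      have h3 := hL3 z.1 z.2 k hz1.1 hk1 hk2
      set x := lf (L k) (vtx (L z.1) (L z.2))
      by_contra hcc
      push Not at hcc
      have h4 : (lf (L k) p * lf (L k) q) * (x * x) ≥ 0 := by
        have := mul_nonneg hcc.1 hcc.2
        nlinarith
      have : 0 < x * x := mul_self_pos.2 h3
      nlinarith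
    have h3 := hw2 z.1
    have h4 := hw2 z.2
    have h5 : 8 / R * W = 8 * (W / R) := by ring
    have h6 : ρ = 3 / 2 * (W / R) := by rw [hρ]; ring
    have : 0 < W / R := by positivity
    linarith [hz1.2, hz2.2]
  have htot : ∑ p ∈ X, ∑ z ∈ B p, w z.1 * w z.2 ≤ W * W := by
    rw [← Finset.sum_biUnion hdisj]
    refine (Finset.sum_le_sum_of_subset_of_nonneg (Finset.subset_univ _) 
      (fun z _ _ => mul_nonneg (hw _) (hw _))).trans ?_
    rw [hW, Finset.sum_mul_sum, ← Finset.univ_product_univ, Finset.sum_product]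
  have hlow : n * (ρ * ρ) ≤ ∑ p ∈ X, ∑ z ∈ B p, w z.1 * w z.2 := by
    have := Finset.card_nsmul_le_sum X _ _ hB
    rwa [nsmul_eq_mul] at this
  have : n * (ρ * ρ) = 9 / 4 * (W * W) := by
    rw [hρ, ← hRR]; field_simp; ring
  nlinarith

end ball

lemma ev_ne (a b : ℝ) (hb : b ≠ 0) : ∀ᶠ η in nhdsWithin (0:ℝ) {0}ᶜ, a + η * b ≠ 0 := by
  by_cases ha : a = 0
  · filter_upwards [self_mem_nhdsWithin] with η hη
    rw [ha, zero_add]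
    exact mul_ne_zero hη hb
  · have : ContinuousAt (fun η : ℝ => a + η * b) 0 := by fun_prop
    exact (this.eventually_ne (by simpa using ha)).filter_mono nhdsWithin_le_nhds

lemma ev_sign (f : ℝ → ℝ) (hf : Continuous f) (h : f 0 ≠ 0) :
    ∀ᶠ η in nhdsWithin (0:ℝ) {0}ᶜ, 0 < f 0 * f η := by
  have h1 : ContinuousAt (fun η : ℝ => f 0 * f η) 0 := by fun_prop
  have h2 : ∀ᶠ η in nhds (0:ℝ), 0 < f 0 * f η := 
    h1.eventually (lt_mem_nhds (mul_self_pos.2 h))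
  exact h2.filter_mono nhdsWithin_le_nhds

lemma perturb1 {κ : Type*} [Fintype κ] (L : κ → ℝ × ℝ) (X : Finset Pt)
    (hp : ∀ p ∈ X, ∀ i, lf (L i) p ≠ 0) : ∃ L' : κ → ℝ × ℝ,
    (∀ p ∈ X, ∀ i, 0 < lf (L i) p * lf (L' i) p) ∧ (∀ i j, i ≠ j → (L' i).1 ≠ (L' j).1) := by
  let c : κ → ℝ := fun i => ((Fintype.equivFin κ i : ℕ) : ℝ)
  have hc : ∀ i j, i ≠ j → c i ≠ c j := by
    intro i j hij h
    apply hij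
    simpa [c, Fin.val_inj] using h
  have h1 : ∀ᶠ η in nhdsWithin (0:ℝ) {0}ᶜ, ∀ p ∈ X, ∀ i, 
      0 < lf (L i) p * lf ((L i).1 + η * c i, (L i).2) p := by
    rw [Filter.eventually_all_finset]
    intro p hpX
    rw [Filter.eventually_all]
    intro i
    have := ev_sign (fun η => lf ((L i).1 + η * c i, (L i).2) p) (by unfold lf; fun_prop)
      (by simpa using hp p hpX i)
    simpa using this
  have h2 : ∀ᶠ η in nhdsWithin (0:ℝ) {0}ᶜ, ∀ i j, i ≠ j → 
      (L i).1 + η * c i ≠ (L j).1 + η * c j := by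
    rw [Filter.eventually_all]
    intro i
    rw [Filter.eventually_all]
    intro j
    by_cases hij : i = j
    · simp [hij]
    filter_upwards [ev_ne ((L i).1 - (L j).1) (c i - c j) (sub_ne_zero.2 (hc i j hij))] with η h _ h'
    apply h
    linarith
  obtain ⟨η, h3, h4⟩ := (h1.and h2).exists
  exact ⟨fun i => ((L i).1 + η * c i, (L i).2), h3, h4⟩

lemma perturb2 {κ : Type*} [Fintype κ] (L : κ → ℝ × ℝ) (X : Finset Pt)
    (hL : ∀ i j, i ≠ j → (L i).1 ≠ (L j).1)
    (hp : ∀ p ∈ X, ∀ i, lf (L i) p ≠ 0) : ∃ L' : κ → ℝ × ℝ,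
    (∀ p ∈ X, ∀ i, 0 < lf (L i) p * lf (L' i) p) ∧ (∀ i j, i ≠ j → (L' i).1 ≠ (L' j).1) ∧
    (∀ i j k, i ≠ j → k ≠ i → k ≠ j → lf (L' k) (vtx (L' i) (L' j)) ≠ 0) := by
  have h1 : ∀ᶠ η in nhdsWithin (0:ℝ) {0}ᶜ, ∀ p ∈ X, ∀ i, 
      0 < lf (L i) p * lf ((L i).1, (L i).2 + η * (L i).1 ^ 2) p := by
    rw [Filter.eventually_all_finset]
    intro p hpX
    rw [Filter.eventually_all]
    intro i
    have := ev_sign (fun η => lf ((L i).1, (L i).2 + η * (L i).1 ^ 2) p) (by unfold lf; fun_prop)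
      (by simpa using hp p hpX i)
    simpa using this
  have h2 : ∀ᶠ η in nhdsWithin (0:ℝ) {0}ᶜ, ∀ i j k, i ≠ j → k ≠ i → k ≠ j →
      lf ((L k).1, (L k).2 + η * (L k).1 ^ 2) (vtx ((L i).1, (L i).2 + η * (L i).1 ^ 2) 
      ((L j).1, (L j).2 + η * (L j).1 ^ 2)) ≠ 0 := by
    rw [Filter.eventually_all]
    intro i
    rw [Filter.eventually_all]
    intro j
    rw [Filter.eventually_all]
    intro k
    by_cases hij : i = j
    · simp [hij]
    by_cases hik : k = i
    · simp [hik]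
    by_cases hjk : k = j
    · simp [hjk]
    have e1 := sub_ne_zero.2 (hL i j hij)
    have e2 := sub_ne_zero.2 (hL k i hik)
    have e3 := sub_ne_zero.2 (hL k j hjk)
    filter_upwards [ev_ne (((L j).2 - (L i).2) * ((L i).1 - (L k).1) - 
      ((L k).2 - (L i).2) * ((L i).1 - (L j).1)) (((L i).1 - (L j).1) * ((L k).1 - (L i).1) * 
      ((L j).1 - (L k).1)) (mul_ne_zero (mul_ne_zero e1 e2) (by intro h; apply e3; linarith))] 
      with η h _ _ _ h'
    apply h
    unfold vtx at h'
    rw [lf_on _ _ (show ((L i).1, (L i).2 + η * (L i).1 ^ 2).1 ≠ 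
      ((L k).1, (L k).2 + η * (L k).1 ^ 2).1 from hL i k (fun h => hik h.symm))] at h'
    have e2' : (L i).1 - (L k).1 ≠ 0 := by intro h; apply e2; linarith
    rw [mul_eq_zero] at h'
    replace h' := h'.resolve_left e2'
    unfold ux at h'
    simp only at h'
    rw [sub_eq_zero, div_eq_div_iff e1 e2'] at h'
    linear_combination h'
  obtain ⟨η, h3, h4⟩ := (h1.and h2).exists
  exact ⟨fun i => ((L i).1, (L i).2 + η * (L i).1 ^ 2), h3, hL, h4⟩

lemma short_edge {ι : Type*} [Fintype ι] (L : ι → ℝ × ℝ) (w : ι → ℝ) 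
    (hw : ∀ i, 0 ≤ w i) (X : Finset Pt) (hX : 2 ≤ X.card) (hp : ∀ p ∈ X, ∀ i, lf (L i) p ≠ 0) :
    ∃ p ∈ X, ∃ q ∈ X, p ≠ q ∧ dsep L w p q ≤ 8 / √X.card * ∑ i, w i := by
  classical
  obtain ⟨L1, h1, h1'⟩ := perturb1 (κ := ι × Fin X.card) (fun z => L z.1) X 
    (fun p hpX i => hp p hpX i.1)
  obtain ⟨L2, h2, h2', h2''⟩ := perturb2 L1 X h1' 
    (fun p hpX i h => by have := h1 p hpX i; rw [h] at this; simp at this)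
  have hn : (0:ℝ) < X.card := by exact_mod_cast (by omega : 0 < X.card)
  have hsum : ∑ z : ι × Fin X.card, w z.1 / X.card = ∑ i, w i := by
    rw [← Finset.univ_product_univ, Finset.sum_product]
    refine Finset.sum_congr rfl fun i _ => ?_
    simp
    field_simp
  have h3 : ∀ p ∈ X, ∀ z, 0 < lf (L z.1) p * lf (L2 z) p := by
    intro p hpX z
    have a1 := h1 p hpX z
    have a2 := h2 p hpX z
    have a3 := mul_pos a1 a2
    by_contra hc
    nlinarith [mul_self_nonneg (lf (L1 z) p)]
  obtain ⟨p, hpX, q, hqX, hpq, hd⟩ := short_generic L2 h2' h2'' (fun z => w z.1 / X.card) 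
    (fun z => div_nonneg (hw _) hn.le) X hX 
    (fun p hpX i h => by have := h2 p hpX i; rw [h] at this; simp at this)
    (fun z => by
      rw [hsum]
      exact div_le_div_of_nonneg_right 
        (Finset.single_le_sum (fun i _ => hw i) (Finset.mem_univ _)) hn.le)
  refine ⟨p, hpX, q, hqX, hpq, ?_⟩
  rw [hsum] at hd
  refine le_trans (le_of_eq ?_) hd
  unfold dsep
  rw [Finset.sum_filter, Finset.sum_filter, ← Finset.univ_product_univ, Finset.sum_product]
  refine Finset.sum_congr rfl fun i _ => ?_
  have : ∀ j : Fin X.card, (lf (L2 (i, j)) p * lf (L2 (i, j)) q < 0) ↔ 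
      (lf (L i) p * lf (L i) q < 0) := by
    intro j
    have a1 := h3 p hpX (i, j)
    have a2 := h3 q hqX (i, j)
    have a3 := mul_pos a1 a2
    simp only at a3
    constructor
    · intro h
      by_contra hc
      nlinarith
    · intro h
      by_contra hc
      nlinarith
  simp only [this]
  split_ifs
  · simp
    field_simp
  · simp

/-- cyclic tour of `X` -/
def IsTour (X : Finset Pt) (V : ℕ → Pt) : Prop :=
  V X.card = V 0 ∧ (Finset.range X.card).image V = X

/-- indicator of separation -/
noncomputable def sepi (A : ℝ × ℝ) (p q : Pt) : ℕ := if lf A p * lf A q < 0 then 1 else 0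

/-- tour sum -/
def tsum' {M : Type*} [AddCommMonoid M] (φ : Pt → Pt → M) (n : ℕ) (V : ℕ → Pt) : M :=
  ∑ i ∈ Finset.range n, φ (V i) (V (i + 1))

/-- insertion into a tour -/
def insV (V : ℕ → Pt) (i : ℕ) (p : Pt) : ℕ → Pt := fun m =>
  if m ≤ i then V m else if m = i + 1 then p else V (m - 1)

lemma tsum_ins {M : Type*} [AddCommMonoid M] (φ : Pt → Pt → M) (n : ℕ) (V : ℕ → Pt) (i : ℕ) 
    (hi : i < n) (p : Pt) : 
    tsum' φ (n + 1) (insV V i p) + φ (V i) (V (i + 1)) = 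
      tsum' φ n V + (φ (V i) p + φ p (V (i + 1))) := by
  obtain ⟨r, rfl⟩ := Nat.exists_eq_add_of_lt hi
  unfold tsum'
  have e1 : ∑ m ∈ Finset.range (i + r + 1 + 1), φ (insV V i p m) (insV V i p (m + 1)) = 
     (∑ m ∈ Finset.range i, φ (V m) (V (m+1))) + (φ (V i) p + φ p (V (i + 1))) + 
     ∑ m ∈ Finset.range r, φ (V (i + 1 + m)) (V (i + 1 + m + 1)) := by
    rw [show i + r + 1 + 1 = i + 1 + 1 + r by ring, Finset.sum_range_add, Finset.sum_range_succ, 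
      Finset.sum_range_succ, add_assoc (∑ m ∈ Finset.range i, _)]
    congr 1
    · congr 1
      · refine Finset.sum_congr rfl fun m hm => ?_
        rw [Finset.mem_range] at hm
        simp [insV, hm.le, Nat.succ_le_of_lt hm]
      · simp [insV]
    · refine Finset.sum_congr rfl fun m hm => ?_
      have a1 : ¬ (i + 1 + 1 + m ≤ i) := by omega
      have a2 : ¬ (i + 1 + 1 + m = i + 1) := by omega
      have a3 : ¬ (i + 1 + 1 + m + 1 ≤ i) := by omega
      have a4 : ¬ (i + 1 + 1 + m + 1 = i + 1) := by omega
      unfold insV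
      rw [if_neg a1, if_neg a2, if_neg a3, if_neg a4]
      congr 2 <;> omega
  have e2 : ∑ m ∈ Finset.range (i + r + 1), φ (V m) (V (m + 1)) = 
     (∑ m ∈ Finset.range i, φ (V m) (V (m+1))) + φ (V i) (V (i + 1)) + 
     ∑ m ∈ Finset.range r, φ (V (i + 1 + m)) (V (i + 1 + m + 1)) := by
    rw [show i + r + 1 = i + 1 + r by ring, Finset.sum_range_add, Finset.sum_range_succ]
  rw [e1, e2]
  abel

lemma sepi_tri (A : ℝ × ℝ) (p q r : Pt) (hq : lf A q ≠ 0) (hp : lf A p ≠ 0) : 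
    sepi A q p + sepi A p r ≤ 2 * sepi A q p + sepi A q r := by
  unfold sepi
  rcases lt_or_gt_of_ne hq with h1 | h1 <;> rcases lt_or_gt_of_ne hp with h2 | h2 <;>
    rcases lt_trichotomy (lf A r) 0 with h3 | h3 | h3 <;>
    simp [mul_neg_iff, h1, h2, h3, h1.not_gt, h2.not_gt, h3.not_gt]

lemma tour_ins (X : Finset Pt) (p : Pt) (hp : p ∈ X) (V : ℕ → Pt) (hV : IsTour (X.erase p) V) 
    (i : ℕ) (hi : i < (X.erase p).card) : IsTour X (insV V i p) := by
  have hc : X.card = (X.erase p).card + 1 := (Finset.card_erase_add_one hp).symm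
  obtain ⟨h1, h2⟩ := hV
  refine ⟨?_, ?_⟩
  · rw [hc]
    unfold insV
    rw [if_neg (by omega), if_neg (by omega), if_pos (by omega)]
    simpa using h1
  · have : ∀ x, x ∈ X ↔ x = p ∨ x ∈ X.erase p := by
      intro x
      rw [Finset.mem_erase]
      by_cases hx : x = p
      · simp [hx, hp]
      · simp [hx]
    ext x
    rw [this, ← h2, hc]
    simp only [Finset.mem_image, Finset.mem_range]
    constructor
    · rintro ⟨m, hm, rfl⟩
      unfold insV
      split_ifs with a b
      · right; exact ⟨m, by omega, rfl⟩
      · left; rfl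
      · right; exact ⟨m - 1, by omega, rfl⟩
    · rintro (rfl | ⟨m, hm, rfl⟩)
      · exact ⟨i + 1, by omega, by simp [insV]⟩
      · by_cases hmi : m ≤ i
        · exact ⟨m, by omega, by simp [insV, hmi]⟩
        · refine ⟨m + 1, by omega, ?_⟩
          unfold insV
          rw [if_neg (by omega), if_neg (by omega)]
          simp

lemma exp_step (n : ℕ) (hn : 1 ≤ n) : 
    (1 + 8 / √((n + 1 : ℕ):ℝ)) * Real.exp (16 * √(n:ℝ)) ≤ Real.exp (16 * √((n + 1 : ℕ):ℝ)) := by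
  set a := √(n:ℝ)
  set b := √((n + 1 : ℕ):ℝ)
  have ha : a * a = n := Real.mul_self_sqrt (by positivity)
  have hb : b * b = n + 1 := by
    have := Real.mul_self_sqrt (show (0:ℝ) ≤ ((n + 1 : ℕ):ℝ) by positivity)
    rw [this]; push_cast; ring
  have ha0 : 0 ≤ a := Real.sqrt_nonneg _
  have hb0 : 0 < b := Real.sqrt_pos.2 (by positivity)
  have hab : a ≤ b := by nlinarith
  have h1 : 8 / b + 16 * a ≤ 16 * b := by
    have : 8 / b ≤ 16 * (b - a) := by
      rw [div_le_iff₀ hb0]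
      nlinarith
    linarith
  calc _ ≤ Real.exp (8 / b) * Real.exp (16 * a) := by
        gcongr
        have := Real.add_one_le_exp (8 / b)
        linarith
    _ = Real.exp (8 / b + 16 * a) := by rw [Real.exp_add]
    _ ≤ _ := Real.exp_le_exp.2 h1

lemma tour_exists {ι : Type*} [Fintype ι] (L : ι → ℝ × ℝ) (n : ℕ) (hn : 1 ≤ n) : 
    ∀ (w : ι → ℝ) (_ : ∀ i, 0 ≤ w i) (X : Finset Pt) (_ : X.card = n) 
    (_ : ∀ p ∈ X, ∀ i, lf (L i) p ≠ 0), ∃ V, IsTour X V ∧ ∃ k : ι → ℕ, 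
      (∀ i, tsum' (sepi (L i)) n V ≤ 2 * k i) ∧ 
      ∑ i, w i * 2 ^ (k i) ≤ (∑ i, w i) * Real.exp (16 * √(n:ℝ)) := by
  induction n, hn using Nat.le_induction with
  | base =>
    intro w hw X hX hp
    obtain ⟨x, rfl⟩ := Finset.card_eq_one.1 hX
    refine ⟨fun _ => x, ⟨rfl, by simp⟩, fun _ => 0, ?_, ?_⟩
    · intro i
      simp [tsum', sepi, mul_self_nonneg]
    · simp only [pow_zero, mul_one]
      have : 0 ≤ ∑ i, w i := Finset.sum_nonneg fun i _ => hw i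
      exact le_mul_of_one_le_right this (Real.one_le_exp (by positivity))
  | succ n hn ih =>
    intro w hw X hX hp
    obtain ⟨p, hpX, q, hqX, hpq, hd⟩ := short_edge L w hw X (by omega) hp
    have hcard : (X.erase p).card = n := by rw [Finset.card_erase_of_mem hpX, hX]; rfl
    obtain ⟨V, hV, k, hk1, hk2⟩ := ih (fun i => w i * 2 ^ (sepi (L i) q p)) 
      (fun i => mul_nonneg (hw i) (by positivity)) (X.erase p) hcard 
      (fun x hx => hp x (Finset.mem_of_mem_erase hx))
    have hqV : q ∈ (Finset.range (X.erase p).card).image V := by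
      rw [hV.2]; exact Finset.mem_erase.2 ⟨hpq.symm, hqX⟩
    obtain ⟨i, hi, rfl⟩ := Finset.mem_image.1 hqV
    rw [Finset.mem_range] at hi
    refine ⟨insV V i p, tour_ins X p hpX V hV i hi, fun j => sepi (L j) (V i) p + k j, ?_, ?_⟩
    · intro j
      have e1 := tsum_ins (sepi (L j)) n V i (by omega) p
      have e2 := sepi_tri (L j) p (V i) (V (i+1)) (hp _ hqX j) (hp _ hpX j)
      have e3 := hk1 j
      beta_reduce
      omega
    · have e1 : ∑ j, w j * 2 ^ (sepi (L j) (V i) p) = (∑ j, w j) + dsep L w p (V i) := by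
        unfold dsep
        rw [Finset.sum_filter, ← Finset.sum_add_distrib]
        refine Finset.sum_congr rfl fun j _ => ?_
        unfold sepi
        rw [mul_comm (lf (L j) (V i))]
        split_ifs <;> ring
      have e2 : ∑ j, w j * 2 ^ (sepi (L j) (V i) p + k j) = 
          ∑ j, w j * 2 ^ (sepi (L j) (V i) p) * 2 ^ (k j) := 
        Finset.sum_congr rfl fun j _ => by rw [pow_add]; ring
      rw [e2]
      refine hk2.trans ?_
      rw [e1]
      rw [hX] at hd
      calc _ ≤ ((∑ j, w j) * (1 + 8 / √((n + 1 : ℕ):ℝ))) * Real.exp (16 * √(n:ℝ)) := by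
            gcongr
            linarith
        _ = (∑ j, w j) * ((1 + 8 / √((n + 1 : ℕ):ℝ)) * Real.exp (16 * √(n:ℝ))) := by ring
        _ ≤ _ := mul_le_mul_of_nonneg_left (exp_step n hn) (Finset.sum_nonneg fun i _ => hw i)

lemma lf_comb (A : ℝ × ℝ) (p q : Pt) (a b : ℝ) (h : a + b = 1) :
    lf A (a • p + b • q) = a * lf A p + b * lf A q := by
  obtain rfl : a = 1 - b := by linarith
  unfold lf
  simp
  ring

lemma convex_neg (A : ℝ × ℝ) : Convex ℝ {p : Pt | lf A p < 0} := by
  intro p hp q hq a b ha hb hab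
  simp only [mem_ofPred_eq] at *
  rw [lf_comb A p q a b hab]
  rcases ha.eq_or_lt with h | h
  · obtain rfl : b = 1 := by linarith
    rw [← h]; linarith
  · nlinarith

lemma convex_pos' (A : ℝ × ℝ) : Convex ℝ {p : Pt | 0 < lf A p} := by
  intro p hp q hq a b ha hb hab
  simp only [mem_ofPred_eq] at *
  rw [lf_comb A p q a b hab]
  rcases ha.eq_or_lt with h | h
  · obtain rfl : b = 1 := by linarith
    rw [← h]; linarith
  · nlinarith

/-- class of a line -/
noncomputable def cls (X : Finset Pt) (A : ℝ × ℝ) : Finset X :=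
  Finset.univ.filter (fun x : X => lf A x < 0)

open Classical in
/-- all classes -/
noncomputable def allcls (X : Finset Pt) : Finset (Finset X) :=
  Finset.univ.filter (fun c => ∃ A, (∀ x ∈ X, lf A x ≠ 0) ∧ cls X A = c)

lemma shatter_card (X : Finset Pt) (s : Finset X) (h : (allcls X).Shatters s) : s.card ≤ 3 := by
  classical
  by_contra hc
  have hna : ¬ AffineIndependent ℝ (fun x : s => ((x : X) : Pt)) := by
    intro ha
    have h1 := ha.card_le_finrank_succ
    have h2 := Submodule.finrank_le (vectorSpan ℝ (Set.range (fun x : s => ((x : X) : Pt))))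
    have h3 : Module.finrank ℝ Pt = 2 := by simp [Pt]
    rw [h3] at h2
    simp at h1
    omega
  obtain ⟨I, hI⟩ := Convex.radon_partition hna
  obtain ⟨u, hu, hsu⟩ := h (t := s.filter (fun x => ∃ hx : x ∈ s, (⟨x, hx⟩ : s) ∈ I)) 
    (Finset.filter_subset _ _)
  unfold allcls at hu
  simp only [Finset.mem_filter, Finset.mem_univ, true_and] at hu
  obtain ⟨A, hA, rfl⟩ := hu
  have key : ∀ x : s, x ∈ I ↔ lf A (x : X) < 0 := by
    intro x
    have := Finset.ext_iff.1 hsu x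
    simpa [cls] using this.symm
  obtain ⟨z, hz1, hz2⟩ := hI
  have h1 : z ∈ {p : Pt | lf A p < 0} := by
    refine convexHull_min ?_ (convex_neg A) hz1
    rintro _ ⟨x, hx, rfl⟩
    exact (key x).1 hx
  have h2 : z ∈ {p : Pt | 0 < lf A p} := by
    refine convexHull_min ?_ (convex_pos' A) hz2
    rintro _ ⟨x, hx, rfl⟩
    have h3 : ¬ (lf A (x : X) < 0) := fun h => hx ((key x).2 h)
    exact lt_of_le_of_ne (not_lt.1 h3) (hA _ (x : X).2).symm
  simp only [mem_ofPred_eq] at h1 h2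
  linarith

lemma allcls_card (X : Finset Pt) (hX : 1 ≤ X.card) : (allcls X).card ≤ 4 * X.card ^ 3 := by
  refine (Finset.card_le_card_shatterer _).trans ?_
  refine Finset.card_shatterer_le_sum_vcDim.trans ?_
  have hv : (allcls X).vcDim ≤ 3 := by
    unfold Finset.vcDim
    refine Finset.sup_le fun s hs => shatter_card X s (Finset.mem_shatterer.1 hs)
  calc _ ≤ ∑ k ∈ Finset.Iic 3, (Fintype.card X).choose k := 
        Finset.sum_le_sum_of_subset (Finset.Iic_subset_Iic.2 hv)
    _ ≤ ∑ k ∈ Finset.Iic 3, X.card ^ 3 := by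
        refine Finset.sum_le_sum fun k hk => ?_
        rw [Fintype.card_coe]
        exact (Nat.choose_le_pow _ _).trans (Nat.pow_le_pow_right hX (Finset.mem_Iic.1 hk))
    _ = _ := by simp

lemma tour_mem {X : Finset Pt} {V : ℕ → Pt} (hV : IsTour X V) {i : ℕ} (hi : i ≤ X.card) 
    (hX : 1 ≤ X.card) : V i ∈ X := by
  have : ∀ i < X.card, V i ∈ X := by
    intro i hi
    have h2 := hV.2
    have h3 : V i ∈ (Finset.range X.card).image V := 
      Finset.mem_image_of_mem _ (Finset.mem_range.2 hi)
    rwa [h2] at h3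
  rcases hi.eq_or_lt with h | h
  · rw [h, hV.1]; exact this 0 (by omega)
  · exact this i h

lemma tour_inj {X : Finset Pt} {V : ℕ → Pt} (hV : IsTour X V) {i j : ℕ} (hi : i < X.card) 
    (hj : j < X.card) (h : V i = V j) : i = j := by
  have h1 : ((Finset.range X.card).image V).card = (Finset.range X.card).card := by
    rw [hV.2, Finset.card_range]
  exact Finset.card_image_iff.1 h1 (by simpa using hi) (by simpa using hj) h

/-- few crossings -/
def Good (X : Finset Pt) (V : ℕ → Pt) : Prop :=
  ∀ A, (∀ x ∈ X, lf A x ≠ 0) → ((tsum' (sepi A) X.card V : ℕ) : ℝ) ≤ 96 * √X.card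

lemma good_tour (X : Finset Pt) (hX : 1 ≤ X.card) : ∃ V, IsTour X V ∧ Good X V := by
  classical
  have hch : ∀ c : allcls X, ∃ A, (∀ x ∈ X, lf A x ≠ 0) ∧ cls X A = c := by
    intro c
    have := c.2
    unfold allcls at this
    simpa using this
  choose L hL1 hL2 using hch
  obtain ⟨V, hV, k, hk1, hk2⟩ := tour_exists L X.card hX (fun _ => 1) (fun _ => zero_le_one) X rfl
    (fun p hp i => hL1 i p hp)
  refine ⟨V, hV, fun A hA => ?_⟩
  have hc : cls X A ∈ allcls X := by
    unfold allcls
    simp only [Finset.mem_filter, Finset.mem_univ, true_and]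
    exact ⟨A, hA, rfl⟩
  set c : allcls X := ⟨cls X A, hc⟩ with hcdef
  have hsign : ∀ x ∈ X, (lf A x < 0 ↔ lf (L c) x < 0) := by
    intro x hx
    have h1 := hL2 c
    have h2 := Finset.ext_iff.1 h1 ⟨x, hx⟩
    simpa [cls, hcdef] using h2.symm
  have heq : tsum' (sepi A) X.card V = tsum' (sepi (L c)) X.card V := by
    unfold tsum'
    refine Finset.sum_congr rfl fun i hi => ?_
    rw [Finset.mem_range] at hi
    have m1 := tour_mem hV hi.le hX
    have m2 := tour_mem hV (show i + 1 ≤ X.card by omega) hX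
    unfold sepi
    have a1 := hsign _ m1
    have a2 := hsign _ m2
    have : (lf A (V i) * lf A (V (i+1)) < 0) ↔ (lf (L c) (V i) * lf (L c) (V (i+1)) < 0) := by
      have b1 := hA _ m1
      have b2 := hA _ m2
      have b3 := hL1 c _ m1
      have b4 := hL1 c _ m2
      have e : ∀ x : ℝ, x ≠ 0 → (0 < x ↔ ¬ (x < 0)) := fun x hx => 
        ⟨fun h => h.not_gt, fun h => lt_of_le_of_ne (not_lt.1 h) hx.symm⟩
      rw [mul_neg_iff, mul_neg_iff, e _ b1, e _ b2, e _ b3, e _ b4, a1, a2]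
    simp only [this]
  rw [heq]
  have h1 : (2:ℝ) ^ (k c) ≤ (4 * (X.card:ℝ) ^ 3) * Real.exp (16 * √X.card) := by
    calc (2:ℝ) ^ (k c) ≤ ∑ i, (1:ℝ) * 2 ^ (k i) := by
          simp only [one_mul]
          exact Finset.single_le_sum (f := fun i => (2:ℝ) ^ (k i)) (fun i _ => by positivity) 
            (Finset.mem_univ c)
      _ ≤ _ := hk2
      _ ≤ _ := by
        gcongr
        simp only [Finset.sum_const, nsmul_eq_mul, mul_one, Finset.card_univ, Fintype.card_coe]
        exact_mod_cast allcls_card X hX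
  have hn1 : (1:ℝ) ≤ X.card := by exact_mod_cast hX
  set R := √(X.card : ℝ) with hR
  have hRR : R * R = X.card := Real.mul_self_sqrt (by linarith)
  have hR1 : 1 ≤ R := Real.one_le_sqrt.2 hn1
  have h2 : k c * Real.log 2 ≤ Real.log 4 + 6 * Real.log R + 16 * R := by
    have := Real.log_le_log (by positivity) h1
    rw [Real.log_pow, Real.log_mul (by positivity) (by positivity), Real.log_exp, 
      Real.log_mul (by positivity) (by positivity), Real.log_pow, ← hRR, 
      Real.log_mul (by positivity) (by positivity)] at this
    push_cast at this
    linarith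
  have h3 : Real.log R ≤ R := by
    have := Real.log_le_sub_one_of_pos (show 0 < R by linarith)
    linarith
  have h4 : Real.log 4 ≤ 2 := by
    rw [show (4:ℝ) = 2 ^ 2 by norm_num, Real.log_pow]
    have := Real.log_two_lt_d9
    push_cast
    linarith
  have h5 : (1:ℝ)/2 ≤ Real.log 2 := by have := Real.log_two_gt_d9; linarith
  have h6 : (k c : ℝ) ≤ 48 * R := by
    have : (0:ℝ) ≤ k c := Nat.cast_nonneg _
    nlinarith
  have h7 : ((tsum' (sepi (L c)) X.card V : ℕ) : ℝ) ≤ 2 * k c := by exact_mod_cast hk1 c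
  linarith

/-- reversal -/
def revV (V : ℕ → Pt) (j k : ℕ) : ℕ → Pt := fun i =>
  if j < i ∧ i ≤ k then V (j + k + 1 - i) else V i

lemma tsum_rev {M : Type*} [AddCommMonoid M] (φ : Pt → Pt → M) (hφ : ∀ x y, φ x y = φ y x) 
    (n : ℕ) (V : ℕ → Pt) (j k : ℕ) (hjk : j < k) (hk : k < n) :
    tsum' φ n (revV V j k) + (φ (V j) (V (j + 1)) + φ (V k) (V (k + 1))) = 
      tsum' φ n V + (φ (V j) (V k) + φ (V (j + 1)) (V (k + 1))) := by
  obtain ⟨m, rfl⟩ := Nat.exists_eq_add_of_lt hjk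
  obtain ⟨r, rfl⟩ := Nat.exists_eq_add_of_lt hk
  have split : ∀ f : ℕ → M, ∑ i ∈ Finset.range (j + m + 1 + r + 1), f i = 
      ∑ i ∈ Finset.range j, f i + f j + ∑ i ∈ Finset.range m, f (j + 1 + i) + f (j + m + 1) + 
      ∑ i ∈ Finset.range r, f (j + m + 2 + i) := by
    intro f
    rw [show j + m + 1 + r + 1 = j + 1 + m + 1 + r by ring, Finset.sum_range_add, 
      Finset.sum_range_succ, Finset.sum_range_add, Finset.sum_range_succ]
    rw [show j + 1 + m = j + m + 1 by ring]
  unfold tsum'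
  rw [split, split]
  have e1 : ∑ i ∈ Finset.range j, φ (revV V j (j + m + 1) i) (revV V j (j + m + 1) (i + 1)) = 
      ∑ i ∈ Finset.range j, φ (V i) (V (i + 1)) := by
    refine Finset.sum_congr rfl fun i hi => ?_
    rw [Finset.mem_range] at hi
    unfold revV
    rw [if_neg (by omega), if_neg (by omega)]
  have e2 : φ (revV V j (j + m + 1) j) (revV V j (j + m + 1) (j + 1)) = φ (V j) (V (j + m + 1)) := by
    unfold revV
    rw [if_neg (by omega), if_pos (by omega)]
    congr 2; omega
  have e3 : ∑ i ∈ Finset.range m, φ (revV V j (j + m + 1) (j + 1 + i)) 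
      (revV V j (j + m + 1) (j + 1 + i + 1)) = 
      ∑ i ∈ Finset.range m, φ (V (j + 1 + i)) (V (j + 1 + i + 1)) := by
    rw [← Finset.sum_range_reflect (fun i => φ (V (j + 1 + i)) (V (j + 1 + i + 1)))]
    refine Finset.sum_congr rfl fun i hi => ?_
    rw [Finset.mem_range] at hi
    unfold revV
    rw [if_pos (by omega), if_pos (by omega), hφ]
    congr 2 <;> omega
  have e4 : φ (revV V j (j + m + 1) (j + m + 1)) (revV V j (j + m + 1) (j + m + 1 + 1)) = 
      φ (V (j + 1)) (V (j + m + 1 + 1)) := by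
    unfold revV
    rw [if_pos (by omega), if_neg (by omega)]
    congr 2; omega
  have e5 : ∑ i ∈ Finset.range r, φ (revV V j (j + m + 1) (j + m + 2 + i)) 
      (revV V j (j + m + 1) (j + m + 2 + i + 1)) = 
      ∑ i ∈ Finset.range r, φ (V (j + m + 2 + i)) (V (j + m + 2 + i + 1)) := by
    refine Finset.sum_congr rfl fun i hi => ?_
    unfold revV
    rw [if_neg (by omega), if_neg (by omega)]
  rw [e1, e2, e3, e4, e5]
  abel

lemma tour_rev (X : Finset Pt) (V : ℕ → Pt) (hV : IsTour X V) (j k : ℕ) (hjk : j < k) 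
    (hk : k < X.card) : IsTour X (revV V j k) := by
  refine ⟨?_, ?_⟩
  · unfold revV
    rw [if_neg (by omega), if_neg (by omega)]
    exact hV.1
  · rw [← hV.2]
    have hn : ((Finset.range X.card).image V).card = X.card := by rw [hV.2]
    rw [hn]
    ext x
    simp only [Finset.mem_image, Finset.mem_range]
    constructor
    · rintro ⟨i, hi, rfl⟩
      unfold revV
      split_ifs with h
      · exact ⟨_, by omega, rfl⟩
      · exact ⟨i, hi, rfl⟩
    · rintro ⟨i, hi, rfl⟩
      by_cases h : j < i ∧ i ≤ k
      · refine ⟨j + k + 1 - i, by omega, ?_⟩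
        unfold revV
        rw [if_pos (by omega)]
        congr 1; omega
      · exact ⟨i, hi, by unfold revV; rw [if_neg h]⟩

/-- orientation determinant -/
def det3 (p q r : Pt) : ℝ := (q.1 - p.1) * (r.2 - p.2) - (q.2 - p.2) * (r.1 - p.1)

lemma det3_ne {X : Set Pt} (hX : GenPos X) {p q r : Pt} (hp : p ∈ X) (hq : q ∈ X) (hr : r ∈ X)
    (hpq : p ≠ q) (hpr : p ≠ r) (hqr : q ≠ r) : det3 p q r ≠ 0 := by
  intro h
  apply hX p hp q hq r hr hpq hpr hqr
  rw [collinear_iff_of_mem (p₀ := p) (by simp)]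
  refine ⟨q - p, ?_⟩
  unfold det3 at h
  intro x hx
  simp only [mem_insert_iff, mem_singleton_iff] at hx
  rcases hx with rfl | rfl | rfl
  · exact ⟨0, by simp⟩
  · exact ⟨1, by simp⟩
  · by_cases h1 : q.1 - p.1 = 0
    · have h2 : q.2 - p.2 ≠ 0 := by
        intro h2
        apply hpq
        ext <;> linarith
      refine ⟨(x.2 - p.2) / (q.2 - p.2), ?_⟩
      ext
      · simp
        field_simp
        linarith
      · simp
        field_simp
        ring
    · refine ⟨(x.1 - p.1) / (q.1 - p.1), ?_⟩
      ext
      · simp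
        field_simp
        ring
      · simp
        field_simp
        linarith

/-- point on a segment -/
def lm (a b : Pt) (x : ℝ) : Pt := (1 - x) • a + x • b

lemma sepi_cross (A : ℝ × ℝ) (a b c d : Pt) (ha : lf A a ≠ 0) (hb : lf A b ≠ 0) (hc : lf A c ≠ 0)
    (hd : lf A d ≠ 0) (x y : ℝ) (hx : x ∈ Ico (0:ℝ) 1) (hy : y ∈ Ico (0:ℝ) 1) 
    (h : lm a b x = lm c d y) : 
    sepi A a c + sepi A b d ≤ sepi A a b + sepi A c d := by
  have h1 : (1 - x) * lf A a + x * lf A b = (1 - y) * lf A c + y * lf A d := by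
    rw [← lf_comb A a b _ _ (by ring), ← lf_comb A c d _ _ (by ring)]
    exact congrArg _ h
  obtain ⟨hx0, hx1⟩ := hx
  obtain ⟨hy0, hy1⟩ := hy
  unfold sepi
  rcases lt_or_gt_of_ne ha with h2 | h2 <;> rcases lt_or_gt_of_ne hb with h3 | h3 <;>
    rcases lt_or_gt_of_ne hc with h4 | h4 <;> rcases lt_or_gt_of_ne hd with h5 | h5 <;>
    simp [mul_neg_iff, h2, h3, h4, h5, h2.not_gt, h3.not_gt, h4.not_gt, h5.not_gt] <;>
    nlinarith

lemma sepi_comm (A : ℝ × ℝ) (x y : Pt) : sepi A x y = sepi A y x := by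
  unfold sepi; rw [mul_comm]

/-- to the complex plane -/
def toC (p : Pt) : ℂ := ⟨p.1, p.2⟩

/-- euclidean distance -/
noncomputable def ed (p q : Pt) : ℝ := dist (toC p) (toC q)

lemma ed_comm (x y : Pt) : ed x y = ed y x := dist_comm _ _

lemma ed_lm (a b : Pt) (x : ℝ) (hx : x ∈ Ico (0:ℝ) 1) : 
    ed a (lm a b x) + ed (lm a b x) b = ed a b := by
  apply Wbtw.dist_add_dist
  refine ⟨x, ⟨hx.1, hx.2.le⟩, ?_⟩
  apply Complex.ext <;> simp [AffineMap.lineMap_apply, toC, lm] <;> ring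

lemma ed_short (a b c d : Pt) (x y : ℝ) (hx : x ∈ Ico (0:ℝ) 1) (hy : y ∈ Ico (0:ℝ) 1) 
    (h : lm a b x = lm c d y) (h1 : det3 a b c ≠ 0) (h2 : det3 a c d ≠ 0) : 
    ed a c + ed b d < ed a b + ed c d := by
  set O := lm a b x with hO
  have e1 : ed a O + ed O b = ed a b := ed_lm a b x hx
  have e2 : ed c O + ed O d = ed c d := by
    have := ed_lm c d y hy
    rwa [← h] at this
  have e3 : ed b d ≤ ed b O + ed O d := dist_triangle _ _ _
  have e4 : ed a c ≤ ed a O + ed O c := dist_triangle _ _ _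
  have e5 : ed a c ≠ ed a O + ed O c := by
    intro he
    have hw : Wbtw ℝ (toC a) (toC O) (toC c) := dist_add_dist_eq_iff.1 he.symm
    obtain ⟨t, ht, hw⟩ := hw
    have w1 := congrArg Complex.re hw
    have w2 := congrArg Complex.im hw
    rw [hO] at w1 w2
    simp [AffineMap.lineMap_apply, toC, lm] at w1 w2
    unfold det3 at h1 h2
    have hx0 : x = 0 := by
      have : x * ((b.1 - a.1) * (c.2 - a.2) - (b.2 - a.2) * (c.1 - a.1)) = 0 := by
        linear_combination (c.1 - a.1) * w2 - (c.2 - a.2) * w1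
      exact (mul_eq_zero.1 this).resolve_right h1
    have g1 := congrArg Prod.fst h
    have g2 := congrArg Prod.snd h
    rw [hO] at g1 g2
    simp [lm, hx0] at g1 g2
    apply h2
    rw [g1, g2]
    ring
  have e6 := lt_of_le_of_ne e4 e5
  rw [ed_comm O c] at e6
  rw [ed_comm b O] at e3
  linarith

/-- simplicity of the closed polygon -/
def Simple (n : ℕ) (V : ℕ → Pt) : Prop :=
  ∀ j k, j < k → k < n → ∀ x ∈ Ico (0:ℝ) 1, ∀ y ∈ Ico (0:ℝ) 1, 
    lm (V j) (V (j + 1)) x ≠ lm (V k) (V (k + 1)) y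

lemma min_simple (X : Finset Pt) (hG : GenPos (X : Set Pt)) (h3 : 3 ≤ X.card) (V : ℕ → Pt) 
    (hV : IsTour X V) (hgood : Good X V) 
    (hmin : ∀ V', IsTour X V' → Good X V' → tsum' ed X.card V ≤ tsum' ed X.card V') : 
    Simple X.card V := by
  intro j k hjk hk x hx y hy heq
  have mj := tour_mem hV (show j ≤ X.card by omega) (by omega)
  have mj1 := tour_mem hV (show j + 1 ≤ X.card by omega) (by omega)
  have mk := tour_mem hV (show k ≤ X.card by omega) (by omega)
  have mk1 := tour_mem hV (show k + 1 ≤ X.card by omega) (by omega)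
  have nac : V j ≠ V k := fun h => by have := tour_inj hV (by omega) (by omega) h; omega
  have nab : V j ≠ V (j+1) := fun h => by have := tour_inj hV (by omega) (by omega) h; omega
  have ncd : V k ≠ V (k+1) := fun h => by
    by_cases hkn : k + 1 = X.card
    · rw [hkn, hV.1] at h
      have := tour_inj hV (by omega) (by omega) h; omega
    · have := tour_inj hV (by omega) (by omega) h; omega
  have nbd : V (j+1) ≠ V (k+1) := fun h => by
    by_cases hkn : k + 1 = X.card
    · rw [hkn, hV.1] at h
      have := tour_inj hV (by omega) (by omega) h; omega
    · have := tour_inj hV (by omega) (by omega) h; omega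
  have g1 := congrArg Prod.fst heq
  have g2 := congrArg Prod.snd heq
  simp [lm] at g1 g2
  by_cases hbc : j + 1 = k
  · -- consecutive
    have nad : V j ≠ V (k+1) := fun h => by
      by_cases hkn : k + 1 = X.card
      · rw [hkn, hV.1] at h
        have := tour_inj hV (by omega) (by omega) h; omega
      · have := tour_inj hV (by omega) (by omega) h; omega
    rw [hbc] at g1 g2
    have hd := det3_ne hG mj mk mk1 nac nad ncd
    unfold det3 at hd
    have : (1 - x) * ((((V k).1 - (V j).1) * ((V (k+1)).2 - (V j).2) - 
        ((V k).2 - (V j).2) * ((V (k+1)).1 - (V j).1))) = 0 := by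
      linear_combination ((V (k+1)).1 - (V k).1) * g2 - ((V (k+1)).2 - (V k).2) * g1
    rcases mul_eq_zero.1 this with h | h
    · linarith [hx.2]
    · exact hd h
  have nbc : V (j+1) ≠ V k := fun h => hbc (tour_inj hV (by omega) (by omega) h)
  by_cases hda : V (k+1) = V j
  · rw [hda] at g1 g2
    have hd := det3_ne hG mj mj1 mk nab nac nbc
    unfold det3 at hd
    have : (1 - y) * ((((V (j+1)).1 - (V j).1) * ((V k).2 - (V j).2) - 
        ((V (j+1)).2 - (V j).2) * ((V k).1 - (V j).1))) = 0 := by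
      linear_combination ((V (j+1)).2 - (V j).2) * g1 - ((V (j+1)).1 - (V j).1) * g2
    rcases mul_eq_zero.1 this with h | h
    · linarith [hy.2]
    · exact hd h
  have hs := ed_short _ _ _ _ x y hx hy heq (det3_ne hG mj mj1 mk nab nac nbc) 
    (det3_ne hG mj mk mk1 nac (fun h => hda h.symm) ncd)
  have h1 := hmin (revV V j k) (tour_rev X V hV j k hjk hk) (by
    intro A hA
    refine le_trans ?_ (hgood A hA)
    have e1 := tsum_rev (sepi A) (sepi_comm A) X.card V j k hjk hk
    have e2 := sepi_cross A _ _ _ _ (hA _ mj) (hA _ mj1) (hA _ mk) (hA _ mk1) x y hx hy heq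
    exact_mod_cast (by omega : tsum' (sepi A) X.card (revV V j k) ≤ tsum' (sepi A) X.card V))
  have h2 := tsum_rev ed ed_comm X.card V j k hjk hk
  linarith

lemma exists_simple (X : Finset Pt) (hG : GenPos (X : Set Pt)) (h3 : 3 ≤ X.card) : 
    ∃ V, IsTour X V ∧ Good X V ∧ Simple X.card V := by
  let S : Set ℝ := {r | ∃ V, IsTour X V ∧ Good X V ∧ r = tsum' ed X.card V}
  have hfin : S.Finite := by
    refine (Set.finite_range (fun g : Fin (X.card + 1) → X => 
      ∑ i : Fin X.card, ed (g i.castSucc) (g i.succ))).subset ?_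
    rintro r ⟨V, hV, _, rfl⟩
    refine ⟨fun i => ⟨V i, tour_mem hV (by omega) (by omega)⟩, ?_⟩
    unfold tsum'
    rw [Finset.sum_range]
    simp
  have hne : S.Nonempty := by
    obtain ⟨V, hV, hg⟩ := good_tour X (by omega)
    exact ⟨_, V, hV, hg, rfl⟩
  obtain ⟨r, ⟨V, hV, hg, rfl⟩, hmin⟩ := Set.exists_min_image S id hfin hne
  exact ⟨V, hV, hg, min_simple X hG h3 V hV hg (fun V' h1 h2 => hmin _ ⟨V', h1, h2, rfl⟩)⟩

lemma jordan_of_loop (γ : ℝ → Pt) (hγ : Continuous γ) (T : ℝ) (hT : 0 < T) (h0 : γ 0 = γ T) 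
    (hinj : InjOn γ (Ico 0 T)) : IsJordanCurve (γ '' Ico 0 T) := by
  haveI : Fact (0 < 2 * Real.pi) := ⟨Real.two_pi_pos⟩
  have hpi := Real.two_pi_pos
  set c := T / (2 * Real.pi) with hc
  have hc0 : 0 < c := by positivity
  have hcT : c * (2 * Real.pi) = T := by rw [hc]; field_simp
  let δ : ℝ → Pt := fun x => γ (c * x)
  have hδ : Continuous δ := by fun_prop
  have hmem : ∀ x, x ∈ Ico 0 (0 + 2 * Real.pi) → c * x ∈ Ico 0 T := by
    intro x hx
    rw [zero_add] at hx
    refine ⟨mul_nonneg hc0.le hx.1, ?_⟩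
    rw [← hcT]
    exact mul_lt_mul_of_pos_left hx.2 hc0
  let h : AddCircle (2 * Real.pi) → Pt := AddCircle.liftIco (2 * Real.pi) 0 δ
  have hcont : Continuous h := by
    refine AddCircle.liftIco_continuous ?_ hδ.continuousOn
    simp only [δ, zero_add, mul_zero, hcT]
    exact h0
  have hval : ∀ z : AddCircle (2 * Real.pi), ∃ x ∈ Ico 0 (0 + 2 * Real.pi), 
      (x : AddCircle (2 * Real.pi)) = z ∧ h z = δ x := by
    intro z
    refine ⟨AddCircle.equivIco (2 * Real.pi) 0 z, (AddCircle.equivIco (2 * Real.pi) 0 z).2, ?_, rfl⟩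
    exact (AddCircle.equivIco (2 * Real.pi) 0).symm_apply_apply z
  have hhinj : Function.Injective h := by
    intro z1 z2 hz
    obtain ⟨x1, hx1, rfl, e1⟩ := hval z1
    obtain ⟨x2, hx2, rfl, e2⟩ := hval z2
    rw [e1, e2] at hz
    have := hinj (hmem _ hx1) (hmem _ hx2) hz
    rw [mul_left_cancel₀ hc0.ne' this]
  have hrange : Set.range h = γ '' Ico 0 T := by
    ext p
    constructor
    · rintro ⟨z, rfl⟩
      obtain ⟨x, hx, _, e⟩ := hval z
      exact ⟨c * x, hmem _ hx, e.symm⟩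
    · rintro ⟨y, hy, rfl⟩
      refine ⟨((y / c : ℝ) : AddCircle (2 * Real.pi)), ?_⟩
      have hx : y / c ∈ Ico 0 (0 + 2 * Real.pi) := by
        refine ⟨div_nonneg hy.1 hc0.le, ?_⟩
        rw [zero_add, div_lt_iff₀ hc0, mul_comm, hcT]
        exact hy.2
      show AddCircle.liftIco (2 * Real.pi) 0 δ _ = _
      rw [AddCircle.liftIco_coe_apply hx]
      show γ (c * (y / c)) = γ y
      congr 1
      field_simp
  let iso := Complex.orthonormalBasisOneI.repr
  have hn : ∀ z : Metric.sphere (0 : EuclideanSpace ℝ (Fin 2)) 1, 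
      iso.symm z.1 ∈ Submonoid.unitSphere ℂ := by
    intro z
    have h1 := z.2
    rw [mem_sphere_zero_iff_norm] at h1
    exact mem_sphere_zero_iff_norm.2 (by rw [LinearIsometryEquiv.norm_map, h1])
  let toCirc : Metric.sphere (0 : EuclideanSpace ℝ (Fin 2)) 1 → Circle := 
    fun z => ⟨iso.symm z.1, hn z⟩
  have htc : Continuous toCirc := by
    refine Continuous.subtype_mk ?_ _
    exact iso.symm.continuous.comp continuous_subtype_val
  let F : Metric.sphere (0 : EuclideanSpace ℝ (Fin 2)) 1 → Pt := 
    fun z => h (AddCircle.homeomorphCircle'.symm (toCirc z))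
  have hF : Continuous F := hcont.comp (AddCircle.homeomorphCircle'.symm.continuous.comp htc)
  have hFinj : Function.Injective F := by
    intro z1 z2 hz
    have := AddCircle.homeomorphCircle'.symm.injective (hhinj hz)
    have := congrArg Subtype.val this
    exact Subtype.ext (iso.symm.injective this)
  have hFr : Set.range F = γ '' Ico 0 T := by
    rw [← hrange]
    ext p
    constructor
    · rintro ⟨z, rfl⟩; exact ⟨_, rfl⟩
    · rintro ⟨z, rfl⟩
      have hz : ‖iso (AddCircle.homeomorphCircle' z : Circle).1‖ = 1 := by
        rw [LinearIsometryEquiv.norm_map]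
        exact Circle.norm_coe _
      refine ⟨⟨iso (AddCircle.homeomorphCircle' z : Circle).1, 
        mem_sphere_zero_iff_norm.2 hz⟩, ?_⟩
      show h (AddCircle.homeomorphCircle'.symm _) = h z
      congr 1
      rw [Homeomorph.symm_apply_eq]
      apply Subtype.ext
      exact iso.symm_apply_apply _
  classical
  let f : EuclideanSpace ℝ (Fin 2) → Pt := fun z => 
    if hz : z ∈ Metric.sphere (0 : EuclideanSpace ℝ (Fin 2)) 1 then F ⟨z, hz⟩ else 0
  have hfF : ∀ z : Metric.sphere (0 : EuclideanSpace ℝ (Fin 2)) 1, f z = F z := by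
    intro z
    simp only [f]
    rw [dif_pos z.2]
  refine ⟨f, ?_, ?_, ?_⟩
  · rw [continuousOn_iff_continuous_domRestrict]
    exact hF.congr (fun z => (hfF z).symm)
  · intro z1 h1 z2 h2 hz
    rw [hfF ⟨z1, h1⟩, hfF ⟨z2, h2⟩] at hz
    exact congrArg Subtype.val (hFinj hz)
  · rw [← hFr]
    ext p
    constructor
    · rintro ⟨z, rfl⟩
      exact ⟨z, z.2, hfF z⟩
    · rintro ⟨z, hz, rfl⟩
      exact ⟨⟨z, hz⟩, (hfF ⟨z, hz⟩).symm⟩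

/-- the polygonal loop -/
noncomputable def poly (n : ℕ) (V : ℕ → Pt) (x : ℝ) : Pt := 
  V 0 + ∑ k ∈ Finset.range n, (max 0 (min 1 (x - k))) • (V (k + 1) - V k)

lemma poly_cont (n : ℕ) (V : ℕ → Pt) : Continuous (poly n V) := by
  unfold poly; fun_prop

lemma poly_eq (n : ℕ) (V : ℕ → Pt) (k : ℕ) (hk : k < n) (y : ℝ) (hy : y ∈ Icc (0:ℝ) 1) : 
    poly n V (k + y) = lm (V k) (V (k + 1)) y := by
  obtain ⟨r, rfl⟩ := Nat.exists_eq_add_of_lt hk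
  unfold poly
  rw [show k + r + 1 = k + 1 + r by ring, Finset.sum_range_add, Finset.sum_range_succ]
  have e1 : ∑ i ∈ Finset.range k, (max 0 (min 1 ((k:ℝ) + y - i))) • (V (i + 1) - V i) = V k - V 0 := by
    rw [← Finset.sum_range_sub]
    refine Finset.sum_congr rfl fun i hi => ?_
    rw [Finset.mem_range] at hi
    have : (i:ℝ) + 1 ≤ k := by exact_mod_cast hi
    rw [min_eq_left (by linarith [hy.1]), max_eq_right (by norm_num), one_smul]
  have e2 : ∑ i ∈ Finset.range r, (max 0 (min 1 ((k:ℝ) + y - ((k + 1 + i : ℕ) : ℝ)))) • 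
      (V (k + 1 + i + 1) - V (k + 1 + i)) = 0 := by
    refine Finset.sum_eq_zero fun i _ => ?_
    have : (0:ℝ) ≤ i := Nat.cast_nonneg i
    rw [max_eq_left, zero_smul]
    refine (min_le_right _ _).trans ?_
    push_cast
    linarith [hy.2]
  rw [e1, e2, show (k:ℝ) + y - k = y by ring, min_eq_right hy.2, max_eq_right hy.1]
  unfold lm
  ext <;> simp <;> ring

lemma decomp (n : ℕ) (x : ℝ) (hx : x ∈ Ico (0:ℝ) n) : 
    ∃ k : ℕ, k < n ∧ ∃ y ∈ Ico (0:ℝ) 1, x = k + y := by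
  refine ⟨⌊x⌋₊, (Nat.floor_lt hx.1).2 hx.2, x - ⌊x⌋₊, ⟨?_, ?_⟩, by ring⟩
  · linarith [Nat.floor_le hx.1]
  · linarith [Nat.lt_floor_add_one x]

lemma poly_image (n : ℕ) (V : ℕ → Pt) (p : Pt) : p ∈ poly n V '' Ico 0 (n:ℝ) ↔ 
    ∃ k < n, ∃ y ∈ Ico (0:ℝ) 1, p = lm (V k) (V (k + 1)) y := by
  constructor
  · rintro ⟨x, hx, rfl⟩
    obtain ⟨k, hk, y, hy, rfl⟩ := decomp n x hx
    exact ⟨k, hk, y, hy, poly_eq n V k hk y ⟨hy.1, hy.2.le⟩⟩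
  · rintro ⟨k, hk, y, hy, rfl⟩
    refine ⟨k + y, ⟨?_, ?_⟩, poly_eq n V k hk y ⟨hy.1, hy.2.le⟩⟩
    · have : (0:ℝ) ≤ k := Nat.cast_nonneg k
      linarith [hy.1]
    · have : (k:ℝ) + 1 ≤ n := by exact_mod_cast hk
      linarith [hy.2]

lemma poly_jordan (X : Finset Pt) (h3 : 3 ≤ X.card) (V : ℕ → Pt) (hV : IsTour X V) 
    (hs : Simple X.card V) : IsJordanCurve (poly X.card V '' Ico 0 (X.card : ℝ)) := by
  set n := X.card with hn
  apply jordan_of_loop _ (poly_cont n V)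
  · exact_mod_cast (by omega : 0 < n)
  · have e1 := poly_eq n V 0 (by omega) 0 (by simp)
    have e2 := poly_eq n V (n - 1) (by omega) 1 (by simp)
    have e3 : (((n - 1 : ℕ) : ℝ)) + 1 = n := by
      have : n - 1 + 1 = n := by omega
      exact_mod_cast this
    rw [e3] at e2
    simp [lm] at e1 e2
    rw [e1, e2, show n - 1 + 1 = n by omega, hV.1]
  · intro x hx x' hx' heq
    obtain ⟨k, hk, y, hy, rfl⟩ := decomp n x hx
    obtain ⟨k', hk', y', hy', rfl⟩ := decomp n x' hx'
    rw [poly_eq n V k hk y ⟨hy.1, hy.2.le⟩, poly_eq n V k' hk' y' ⟨hy'.1, hy'.2.le⟩] at heq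
    rcases lt_trichotomy k k' with h | h | h
    · exact absurd heq (hs k k' h hk' y hy y' hy')
    · subst h
      have hne : V k ≠ V (k+1) := fun h => by
        by_cases hkn : k + 1 = X.card
        · rw [hkn, hV.1] at h
          have := tour_inj hV (by omega) (by omega) h; omega
        · have := tour_inj hV (by omega) (by omega) h; omega
      have g : (y - y') • (V (k+1) - V k) = 0 := by
        unfold lm at heq
        have := sub_eq_zero.2 heq
        rw [← this]
        module
      rcases smul_eq_zero.1 g with g | g
      · have : y = y' := by linarith
        rw [this]
      · exact absurd (sub_eq_zero.1 g).symm hne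
    · exact absurd heq.symm (hs k' k h hk y' hy' y hy)

lemma line_class (X : Finset Pt) (a b c : ℝ) : ∃ A, (∀ x ∈ X, lf A x ≠ 0) ∧ ∀ x ∈ X, ∀ y ∈ X, 
    (a * x.1 + b * x.2 - c) * (a * y.1 + b * y.2 - c) < 0 → lf A x * lf A y < 0 := by
  have h1 : ∀ᶠ η in nhdsWithin (0:ℝ) {0}ᶜ, b + η * 1 ≠ 0 := ev_ne b 1 one_ne_zero
  have h2 : ∀ᶠ η in nhdsWithin (0:ℝ) {0}ᶜ, ∀ x ∈ X, (a * x.1 + b * x.2 - c) ≠ 0 → 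
      0 < (a * x.1 + b * x.2 - c) * (a * x.1 + (b + η) * x.2 - c) := by
    rw [Filter.eventually_all_finset]
    intro x hx
    by_cases h : a * x.1 + b * x.2 - c = 0
    · simp [h]
    have := ev_sign (fun η => a * x.1 + (b + η) * x.2 - c) (by fun_prop) (by simpa using h)
    simp only [add_zero] at this
    filter_upwards [this] with η h' _ using h'
  obtain ⟨η, hb, hη⟩ := (h1.and h2).exists
  rw [mul_one] at hb
  set b' := b + η
  have h3 : ∀ᶠ θ in nhdsWithin (0:ℝ) {0}ᶜ, ∀ x ∈ X, (a * x.1 + b' * x.2 - c) + θ * 1 ≠ 0 := by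
    rw [Filter.eventually_all_finset]
    intro x hx
    exact ev_ne _ 1 one_ne_zero
  have h4 : ∀ᶠ θ in nhdsWithin (0:ℝ) {0}ᶜ, ∀ x ∈ X, (a * x.1 + b' * x.2 - c) ≠ 0 → 
      0 < (a * x.1 + b' * x.2 - c) * (a * x.1 + b' * x.2 - c + θ) := by
    rw [Filter.eventually_all_finset]
    intro x hx
    by_cases h : a * x.1 + b' * x.2 - c = 0
    · simp [h]
    have := ev_sign (fun η => a * x.1 + b' * x.2 - c + η) (by fun_prop) (by simpa using h)
    simp only [add_zero] at this
    filter_upwards [this] with η h' _ using h'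
  obtain ⟨θ, hθ1, hθ2⟩ := (h3.and h4).exists
  have e : ∀ x : Pt, lf (-a / b', (c - θ) / b') x = (a * x.1 + b' * x.2 - c + θ) / b' := by
    intro x
    unfold lf
    field_simp
    ring
  refine ⟨(-a / b', (c - θ) / b'), ?_, ?_⟩
  · intro x hx
    rw [e]
    have := hθ1 x hx
    rw [mul_one] at this
    exact div_ne_zero this hb
  · intro x hx y hy hxy
    rw [e, e, div_mul_div_comm]
    apply div_neg_of_neg_of_pos _ (mul_self_pos.2 hb)
    have key : ∀ x ∈ X, (a * x.1 + b * x.2 - c) ≠ 0 → 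
        0 < (a * x.1 + b * x.2 - c) * (a * x.1 + b' * x.2 - c + θ) := by
      intro x hx h
      have a1 := hη x hx h
      have a2 := hθ2 x hx (fun h' => by rw [h'] at a1; simp at a1)
      by_contra hc
      nlinarith [mul_pos a1 a2, mul_self_nonneg (a * x.1 + b' * x.2 - c)]
    have k1 := key x hx (fun h => by rw [h] at hxy; simp at hxy)
    have k2 := key y hy (fun h => by rw [h] at hxy; simp at hxy)
    by_contra hc
    nlinarith [mul_pos k1 k2]

lemma on_line_card (X : Finset Pt) (hG : GenPos (X : Set Pt)) (a b c : ℝ) (hab : a ≠ 0 ∨ b ≠ 0) : 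
    (X.filter (fun x => a * x.1 + b * x.2 - c = 0)).card ≤ 2 := by
  by_contra hc
  push Not at hc
  obtain ⟨p, hp, q, hq, r, hr, hpq, hpr, hqr⟩ := Finset.two_lt_card.1 hc
  rw [Finset.mem_filter] at hp hq hr
  apply det3_ne hG hp.1 hq.1 hr.1 hpq hpr hqr
  unfold det3
  have e1 := hp.2
  have e2 := hq.2
  have e3 := hr.2
  rcases hab with h | h
  · apply mul_left_cancel₀ h
    linear_combination (r.2 - p.2) * (e2 - e1) - (q.2 - p.2) * (e3 - e1)
  · apply mul_left_cancel₀ h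
    linear_combination (q.1 - p.1) * (e3 - e1) - (r.1 - p.1) * (e2 - e1)

lemma edges_card (X : Finset Pt) (hG : GenPos (X : Set Pt)) (h3 : 3 ≤ X.card) (V : ℕ → Pt) 
    (hV : IsTour X V) (hg : Good X V) (a b c : ℝ) (hab : a ≠ 0 ∨ b ≠ 0) : 
    (((Finset.range X.card).filter (fun k => (a * (V k).1 + b * (V k).2 - c) * 
      (a * (V (k+1)).1 + b * (V (k+1)).2 - c) ≤ 0)).card : ℝ) ≤ 100 * √X.card := by
  obtain ⟨A, hA1, hA2⟩ := line_class X a b c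
  have h1 := hg A hA1
  have hcard : tsum' (sepi A) X.card V = 
      ((Finset.range X.card).filter (fun k => lf A (V k) * lf A (V (k+1)) < 0)).card := by
    unfold tsum' sepi
    rw [Finset.card_filter]
  have hE1 : ((Finset.range X.card).filter 
      (fun k => a * (V k).1 + b * (V k).2 - c = 0)).card ≤ 2 := by
    refine le_trans (Finset.card_le_card_of_injOn V ?_ ?_) (on_line_card X hG a b c hab)
    · intro k hk
      simp only [Finset.coe_filter, Finset.mem_range, mem_ofPred_eq] at hk ⊢
      exact ⟨tour_mem hV hk.1.le (by omega), hk.2⟩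
    · intro k hk k' hk' h
      simp only [Finset.coe_filter, Finset.mem_range, mem_ofPred_eq] at hk hk'
      exact tour_inj hV hk.1 hk'.1 h
  have hE2 : ((Finset.range X.card).filter 
      (fun k => a * (V (k+1)).1 + b * (V (k+1)).2 - c = 0)).card ≤ 2 := by
    refine le_trans (Finset.card_le_card_of_injOn (fun k => V (k+1)) ?_ ?_) 
      (on_line_card X hG a b c hab)
    · intro k hk
      simp only [Finset.coe_filter, Finset.mem_range, mem_ofPred_eq] at hk ⊢
      exact ⟨tour_mem hV (by omega) (by omega), hk.2⟩
    · intro k hk k' hk' h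
      simp only [Finset.coe_filter, Finset.mem_range, mem_ofPred_eq] at hk hk'
      simp only at h
      by_cases hkn : k + 1 = X.card <;> by_cases hkn' : k' + 1 = X.card
      · omega
      · rw [hkn, hV.1] at h
        have := tour_inj hV (by omega) (by omega) h; omega
      · rw [hkn', hV.1] at h
        have := tour_inj hV (by omega) (by omega) h; omega
      · have := tour_inj hV (by omega) (by omega) h; omega
  have hsub : ((Finset.range X.card).filter (fun k => (a * (V k).1 + b * (V k).2 - c) * 
      (a * (V (k+1)).1 + b * (V (k+1)).2 - c) ≤ 0)) ⊆ 
      ((Finset.range X.card).filter (fun k => lf A (V k) * lf A (V (k+1)) < 0)) ∪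
      (((Finset.range X.card).filter (fun k => a * (V k).1 + b * (V k).2 - c = 0)) ∪
      ((Finset.range X.card).filter (fun k => a * (V (k+1)).1 + b * (V (k+1)).2 - c = 0))) := by
    intro k hk
    simp only [Finset.mem_filter, Finset.mem_union, Finset.mem_range] at hk ⊢
    rcases hk.2.lt_or_eq with h | h
    · left
      exact ⟨hk.1, hA2 _ (tour_mem hV (by omega) (by omega)) _ 
        (tour_mem hV (by omega) (by omega)) h⟩
    · right
      rcases mul_eq_zero.1 h with h | h
      · left; exact ⟨hk.1, h⟩
      · right; exact ⟨hk.1, h⟩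
  have h5 := (Finset.card_le_card hsub).trans (Finset.card_union_le _ _)
  have h6 := Finset.card_union_le ((Finset.range X.card).filter 
      (fun k => a * (V k).1 + b * (V k).2 - c = 0)) ((Finset.range X.card).filter 
      (fun k => a * (V (k+1)).1 + b * (V (k+1)).2 - c = 0))
  rw [← hcard] at h5
  have h7 := (show _ ≤ tsum' (sepi A) X.card V + 4 by omega : 
    ((Finset.range X.card).filter (fun k => (a * (V k).1 + b * (V k).2 - c) * 
      (a * (V (k+1)).1 + b * (V (k+1)).2 - c) ≤ 0)).card ≤ tsum' (sepi A) X.card V + 4)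
  have h8 : (((Finset.range X.card).filter (fun k => (a * (V k).1 + b * (V k).2 - c) * 
      (a * (V (k+1)).1 + b * (V (k+1)).2 - c) ≤ 0)).card : ℝ) ≤ 
      (tsum' (sepi A) X.card V : ℕ) + 4 := by exact_mod_cast h7
  have h9 : (1:ℝ) ≤ √X.card := Real.one_le_sqrt.2 (by exact_mod_cast (by omega : 1 ≤ X.card))
  linarith

lemma lm_mem_segment (a b : Pt) (y : ℝ) (hy : y ∈ Ico (0:ℝ) 1) : lm a b y ∈ segment ℝ a b :=
  ⟨1 - y, y, by linarith [hy.2], hy.1, by ring, rfl⟩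

lemma segment_sub (X : Finset Pt) (V : ℕ → Pt) (hV : IsTour X V) (k : ℕ) (hk : k < X.card) : 
    segment ℝ (V k) (V (k+1)) ⊆ poly X.card V '' Ico 0 (X.card : ℝ) := by
  rintro p ⟨s, t, hs, ht, hst, rfl⟩
  rw [poly_image]
  rcases hs.eq_or_lt with h | h
  · obtain rfl : t = 1 := by linarith
    by_cases hkn : k + 1 = X.card
    · refine ⟨0, by omega, 0, by simp, ?_⟩
      rw [hkn, hV.1, ← h]
      simp [lm]
    · refine ⟨k + 1, by omega, 0, by simp, ?_⟩
      rw [← h]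
      simp [lm]
  · refine ⟨k, hk, t, ⟨ht, by linarith⟩, ?_⟩
    unfold lm
    rw [← hst]
    simp

lemma poly_stab (X : Finset Pt) (hG : GenPos (X : Set Pt)) (h3 : 3 ≤ X.card) (V : ℕ → Pt) 
    (hV : IsTour X V) (hg : Good X V) : 
    StabLER (poly X.card V '' Ico 0 (X.card : ℝ)) (100 * √X.card) := by
  rintro l ⟨a, b, c, hab, rfl⟩ f hf
  set J := poly X.card V '' Ico 0 (X.card : ℝ) with hJ
  have hk : ∀ i, ∃ k < X.card, f i ∈ segment ℝ (V k) (V (k+1)) := by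
    intro i
    obtain ⟨k, hk, y, hy, e⟩ := (poly_image _ _ _).1 (hf i).1
    exact ⟨k, hk, by rw [e]; exact lm_mem_segment _ _ _ hy⟩
  choose κ hκ1 hκ2 using hk
  have hcard := Nat.le_floor (edges_card X hG h3 V hV hg a b c hab)
  set E := (Finset.range X.card).filter (fun k => (a * (V k).1 + b * (V k).2 - c) * 
      (a * (V (k+1)).1 + b * (V (k+1)).2 - c) ≤ 0) with hE
  have hmaps : ∀ i ∈ (Finset.univ : Finset (Fin (⌊100 * √(X.card : ℝ)⌋₊ + 1))), κ i ∈ E := by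
    intro i _
    rw [hE, Finset.mem_filter, Finset.mem_range]
    refine ⟨hκ1 i, ?_⟩
    obtain ⟨s, t, hs, ht, hst, e⟩ := hκ2 i
    have h1 := (hf i).2
    simp only [mem_ofPred_eq] at h1
    rw [← e] at h1
    simp at h1
    set u := V (κ i)
    set v := V (κ i + 1)
    obtain rfl : s = 1 - t := by linarith
    have h2 : (1 - t) * (a * u.1 + b * u.2 - c) + t * (a * v.1 + b * v.2 - c) = 0 := by
      linear_combination h1
    set x := a * u.1 + b * u.2 - c
    set y := a * v.1 + b * v.2 - c
    by_contra hc
    push Not at hc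
    rcases pos_and_pos_or_neg_and_neg_of_mul_pos hc with ⟨h, h'⟩ | ⟨h, h'⟩
    · nlinarith [mul_nonneg hs h.le, mul_nonneg ht h'.le]
    · nlinarith [mul_nonneg hs (neg_pos.2 h).le, mul_nonneg ht (neg_pos.2 h').le]
  obtain ⟨i, _, j, _, hij, he⟩ := Finset.exists_ne_map_eq_of_card_lt_of_maps_to 
    (by rw [Finset.card_univ, Fintype.card_fin]; omega) hmaps
  refine ⟨i, j, hij, ?_⟩
  apply connectedComponentIn_eq
  have hconv : Convex ℝ (segment ℝ (V (κ i)) (V (κ i + 1)) ∩ 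
      {p : Pt | a * p.1 + b * p.2 = c}) := by
    refine (convex_segment _ _).inter ?_
    intro p hp q hq s t hs ht hst
    simp only [mem_ofPred_eq] at *
    obtain rfl : s = 1 - t := by linarith
    simp
    linear_combination (1 - t) * hp + t * hq
  refine hconv.isPreconnected.subset_connectedComponentIn ⟨hκ2 i, (hf i).2⟩ 
    (inter_subset_inter_left _ (segment_sub X V hV _ (hκ1 i))) ⟨?_, (hf j).2⟩
  rw [he]
  exact hκ2 j

lemma big_case (X : Finset Pt) (hG : GenPos (X : Set Pt)) (h3 : 3 ≤ X.card) : 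
    ∃ J, IsJordanCurve J ∧ (↑X : Set Pt) ⊆ J ∧ StabLER J (100 * √X.card) := by
  obtain ⟨V, hV, hg, hs⟩ := exists_simple X hG h3
  refine ⟨_, poly_jordan X h3 V hV hs, ?_, poly_stab X hG h3 V hV hg⟩
  intro x hx
  have hx' : x ∈ (Finset.range X.card).image V := by rw [hV.2]; exact hx
  obtain ⟨i, hi, rfl⟩ := Finset.mem_image.1 hx'
  rw [Finset.mem_range] at hi
  exact segment_sub X V hV i hi (left_mem_segment _ _ _)

lemma compsLE_mono (S : Set Pt) {d e : ℕ} (h : d ≤ e) (hS : CompsLE S d) : CompsLE S e := by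
  intro f hf
  obtain ⟨i, j, hij, he⟩ := hS (fun i => f (Fin.castLE (by omega) i)) (fun i => hf _)
  exact ⟨_, _, fun h => hij (Fin.castLE_injective _ h), he⟩

lemma stabLER_mono (J : Set Pt) {d e : ℝ} (h : d ≤ e) (hJ : StabLER J d) : StabLER J e :=
  fun l hl => compsLE_mono _ (Nat.floor_le_floor h) (hJ l hl)

lemma det_collinear {p q r : Pt} (h : Collinear ℝ ({p, q, r} : Set Pt)) : det3 p q r = 0 := by
  rw [collinear_iff_of_mem (p₀ := p) (by simp)] at h
  obtain ⟨v, hv⟩ := h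
  obtain ⟨s, hs⟩ := hv q (by simp)
  obtain ⟨t, ht⟩ := hv r (by simp)
  rw [hs, ht]
  simp [det3]
  ring

lemma ext_two (X : Finset Pt) (h2 : X.card = 2) : ∃ Y : Finset Pt, X ⊆ Y ∧ Y.card = 3 ∧ 
    GenPos (Y : Set Pt) := by
  obtain ⟨p, q, hpq, rfl⟩ := Finset.card_eq_two.1 h2
  have hpos : 0 < (q.1 - p.1) ^ 2 + (q.2 - p.2) ^ 2 := by
    by_contra hc
    apply hpq
    have h1 : q.1 - p.1 = 0 := by nlinarith [sq_nonneg (q.1 - p.1), sq_nonneg (q.2 - p.2)]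
    have h2 : q.2 - p.2 = 0 := by nlinarith [sq_nonneg (q.1 - p.1), sq_nonneg (q.2 - p.2)]
    ext <;> linarith
  let r : Pt := (p.1 - (q.2 - p.2), p.2 + (q.1 - p.1))
  have hd : det3 p q r ≠ 0 := by
    have : det3 p q r = (q.1 - p.1) ^ 2 + (q.2 - p.2) ^ 2 := by simp [det3, r]; ring
    rw [this]; exact hpos.ne'
  have hpr : p ≠ r := by
    intro h; apply hd; rw [← h]; simp [det3]
  have hqr : q ≠ r := by
    intro h; apply hd; rw [← h]; simp [det3]; ring
  have hnc : ¬ Collinear ℝ ({p, q, r} : Set Pt) := fun h => hd (det_collinear h)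
  clear_value r
  refine ⟨{p, q, r}, ?_, Finset.card_eq_three.2 ⟨p, q, r, hpq, hpr, hqr, rfl⟩, ?_⟩
  · intro x hx
    simp only [Finset.mem_insert, Finset.mem_singleton] at hx ⊢
    tauto
  · intro x hx y hy z hz hxy hxz hyz hcol
    apply hnc
    convert hcol using 1
    simp only [Finset.coe_insert, Finset.coe_singleton, mem_insert_iff, mem_singleton_iff] at hx hy hz
    ext w
    simp only [mem_insert_iff, mem_singleton_iff]
    rcases hx with rfl | rfl | rfl <;> rcases hy with rfl | rfl | rfl <;> 
      rcases hz with rfl | rfl | rfl <;>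
      (first | exact absurd rfl hxy | exact absurd rfl hxz | exact absurd rfl hyz | tauto)

/-- Lemma 4.3. -/
theorem stmt_8 : ∃ C : ℝ, 0 < C ∧ ∀ X : Finset Pt, GenPos ↑X → 2 ≤ X.card →
    ∃ J, IsJordanCurve J ∧ (↑X : Set Pt) ⊆ J ∧
      StabLER J (C * Real.sqrt X.card) := by
  refine ⟨200, by norm_num, fun X hG h2 => ?_⟩
  rcases h2.eq_or_lt with h | h
  · obtain ⟨Y, hXY, hY, hYG⟩ := ext_two X h.symm
    obtain ⟨J, h1, h2, h3⟩ := big_case Y hYG (by omega)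
    refine ⟨J, h1, fun x hx => h2 (hXY hx), stabLER_mono J ?_ h3⟩
    rw [hY, ← h]
    push_cast
    have : √(3:ℝ) ≤ 2 * √2 := by
      rw [Real.sqrt_le_left (by positivity), mul_pow, Real.sq_sqrt (by norm_num)]
      norm_num
    linarith
  · obtain ⟨J, h1, h2, h3⟩ := big_case X hG h
    refine ⟨J, h1, h2, stabLER_mono J ?_ h3⟩
    have := Real.sqrt_nonneg (X.card : ℝ)
    linarith
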